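/- Let G=(V,E) be a correlation clustering instance and β,λ∈(0,1) with 8β+λ ≤ 3/8. Let F be the pre-clustering: the partition of V into connected components of the graph G̃=(V,E_G̃), where E_G̃ = {uv∈E_H : u or v is heavy}. Then for every integer k∈[n], cost^k_F ≤ (3/β + 1/λ + 1/(βλ) + 8)·opt^k, where opt^k is the minimum of cost^k_𝒞 over all clusterings 𝒞 of V. -/

import Mathlib

open Finset

attribute [local instance] Classical.propDecidable

noncomputable section

variable {V : Type*}

/-- The neighborhood of `u` in the graph of `+`edges `E` (contains `u` itself,
since `E` contains all self-loops). -/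
def Nbr [Fintype V] (E : V → V → Prop) (u : V) : Finset V :=
  Finset.univ.filter (fun v => E u v)

/-- The degree `d(u) = |N(u)|`. -/
def deg [Fintype V] (E : V → V → Prop) (u : V) : ℕ := (Nbr E u).card

/-- `M_{uv} = max (d(u), d(v))`. -/
def Mdeg [Fintype V] (E : V → V → Prop) (u v : V) : ℕ := max (deg E u) (deg E v)

/-- The pruned edge set `E_H = {uv ∈ E : |N(u) Δ N(v)| ≤ β · M_{uv}}`. -/
def EH [Fintype V] (β : ℝ) (E : V → V → Prop) (u v : V) : Prop :=
  E u v ∧ ((symmDiff (Nbr E u) (Nbr E v)).card : ℝ) ≤ β * (Mdeg E u v : ℝ)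

/-- The neighborhood of `u` in the pruned graph `H`. -/
def NH [Fintype V] (β : ℝ) (E : V → V → Prop) (u : V) : Finset V :=
  Finset.univ.filter (fun v => EH β E u v)

/-- The fractional solution: `x_{uu} = 0` and
`x_{uv} = 1 − |N_H(u) ∩ N_H(v)| / M_{uv}` for `u ≠ v`. -/
def xval [Fintype V] (β : ℝ) (E : V → V → Prop) (u v : V) : ℝ :=
  if u = v then 0 else 1 - ((NH β E u ∩ NH β E v).card : ℝ) / (Mdeg E u v : ℝ)

/-- `cost_𝒞(u)`: the number of pairs incident to `u` in disagreement with respect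
to the clustering `C` (given as a labelling function). -/
def costC [Fintype V] {α : Type*} (E : V → V → Prop) (C : V → α) (u : V) : ℕ :=
  (Finset.univ.filter
    (fun v => (E u v ∧ C u ≠ C v) ∨ (¬ E u v ∧ v ≠ u ∧ C u = C v))).card

/-- The top-`k` norm `cost^k_𝒞` of the disagreement vector of the clustering `C`:
the maximum of `∑_{u ∈ T} cost_𝒞(u)` over subsets `T ⊆ V` of size `k`. -/
def costTopK [Fintype V] {α : Type*} (E : V → V → Prop) (C : V → α) (k : ℕ) : ℕ :=
  (Finset.powersetCard k (Finset.univ : Finset V)).sup (fun T => ∑ u ∈ T, costC E C u)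

/-- `d_H(u)`: the degree of `u` in the pruned graph `H`. -/
def dH [Fintype V] (β : ℝ) (E : V → V → Prop) (u : V) : ℕ := (NH β E u).card

/-- A vertex is heavy if it keeps at least a `(1−λ)` fraction of its neighbours in `H`
(i.e. it is not light: `d_H(v) ≥ (1−λ)·d(v)`). -/
def Heavy [Fintype V] (β lam : ℝ) (E : V → V → Prop) (v : V) : Prop :=
  (1 - lam) * (deg E v : ℝ) ≤ (dH β E v : ℝ)

/-- The edge set `E_G̃ = {uv ∈ E_H : u or v is heavy}`. -/
def EGt [Fintype V] (β lam : ℝ) (E : V → V → Prop) (u v : V) : Prop :=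
  EH β E u v ∧ (Heavy β lam E u ∨ Heavy β lam E v)

/-- The graph `G̃ = (V, E_G̃)`. -/
def Gtilde [Fintype V] (β lam : ℝ) (E : V → V → Prop) : SimpleGraph V :=
  SimpleGraph.fromRel (fun u v => EGt β lam E u v)

/-- The pre-clustering `F`: the partition of `V` into connected components of `G̃`,
given by the map sending each vertex to its connected component. -/
def preCluster [Fintype V] (β lam : ℝ) (E : V → V → Prop) :
    V → (Gtilde β lam E).ConnectedComponent :=
  fun v => (Gtilde β lam E).connectedComponentMk v

theorem sum_mul_le_sup_powersetCard [Fintype V] (c : V → ℕ) (w : V → ℝ) (Q : ℝ) (k : ℕ)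
    (hk1 : 1 ≤ k) (hk2 : k ≤ Fintype.card V) (hw0 : ∀ v, 0 ≤ w v) (hwQ : ∀ v, w v ≤ Q)
    (hsum : ∑ v, w v ≤ Q * k) :
    ∑ v, w v * (c v : ℝ) ≤
      Q * (((powersetCard k (univ : Finset V)).sup (fun T => ∑ u ∈ T, c u) : ℕ) : ℝ) := by
  have hne : (powersetCard k (univ : Finset V)).Nonempty :=
    powersetCard_nonempty.2 (by simpa using hk2)
  obtain ⟨T, hT, hTmax⟩ := exists_mem_eq_sup _ hne (fun T : Finset V => ∑ u ∈ T, c u)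
  have hcard : T.card = k := (mem_powersetCard.1 hT).2
  have hswap : ∀ a ∈ T, ∀ b, b ∉ T → c b ≤ c a := by
    intro a ha b hb
    have hb' : b ∉ T.erase a := fun h => hb (mem_of_mem_erase h)
    have hmem : insert b (T.erase a) ∈ powersetCard k (univ : Finset V) := by
      rw [mem_powersetCard]
      refine ⟨subset_univ _, ?_⟩
      rw [card_insert_of_notMem hb', card_erase_of_mem ha, hcard]
      omega
    have h1 := le_sup (f := fun T : Finset V => ∑ u ∈ T, c u) hmem
    rw [hTmax] at h1
    rw [sum_insert hb', ← add_sum_erase T c ha] at h1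
    omega
  obtain ⟨a, ha, hmin⟩ := exists_min_image T c (card_pos.1 (by omega))
  rw [hTmax]
  have hpt : ∀ v, w v * ((c v : ℝ) - c a) ≤ if v ∈ T then Q * ((c v : ℝ) - c a) else 0 := by
    intro v
    split_ifs with hv
    · have : (c a : ℝ) ≤ c v := by exact_mod_cast hmin v hv
      exact mul_le_mul_of_nonneg_right (hwQ v) (by linarith)
    · have : (c v : ℝ) ≤ c a := by exact_mod_cast hswap a ha v hv
      exact mul_nonpos_of_nonneg_of_nonpos (hw0 v) (by linarith)
  have h2 := sum_le_sum (s := (univ : Finset V)) (fun v _ => hpt v)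
  rw [← sum_filter, filter_mem_eq_inter, univ_inter, ← mul_sum, sum_sub_distrib, sum_const,
    hcard] at h2
  simp only [mul_sub, sum_sub_distrib, ← sum_mul, nsmul_eq_mul] at h2
  have h3 : (∑ v, w v) * (c a : ℝ) ≤ Q * k * (c a : ℝ) :=
    mul_le_mul_of_nonneg_right hsum (Nat.cast_nonneg _)
  push_cast
  linarith

/-- A charging scheme whose row and column sums are at most `Q` transfers to top-`k` norms. -/
theorem costTopK_le_of_charging [Fintype V] {α γ : Type*} (E : V → V → Prop) (C : V → α)
    (D : V → γ) (g : V → V → ℝ) (Q : ℝ) (k : ℕ) (hk1 : 1 ≤ k) (hk2 : k ≤ Fintype.card V)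
    (hg : ∀ u v, 0 ≤ g u v) (hrow : ∀ u, ∑ v, g u v ≤ Q) (hcol : ∀ v, ∑ u, g u v ≤ Q)
    (hcost : ∀ u, (costC E C u : ℝ) ≤ ∑ v, g u v * (costC E D v : ℝ)) :
    (costTopK E C k : ℝ) ≤ Q * (costTopK E D k : ℝ) := by
  have hne : (powersetCard k (univ : Finset V)).Nonempty :=
    powersetCard_nonempty.2 (by simpa using hk2)
  obtain ⟨T, hT, hTmax⟩ :=
    exists_mem_eq_sup _ hne (fun T : Finset V => ∑ u ∈ T, costC E C u)
  have hcard : T.card = k := (mem_powersetCard.1 hT).2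
  have hmain := sum_mul_le_sup_powersetCard (costC E D) (fun v => ∑ u ∈ T, g u v) Q k hk1 hk2
    (fun v => sum_nonneg fun u _ => hg u v)
    (fun v => (sum_le_univ_sum_of_nonneg fun u => hg u v).trans (hcol v))
    (by
      rw [sum_comm]
      calc ∑ u ∈ T, ∑ v, g u v ≤ ∑ _u ∈ T, Q := sum_le_sum fun u _ => hrow u
        _ = Q * k := by rw [sum_const, hcard, nsmul_eq_mul, mul_comm])
  unfold costTopK
  refine le_trans ?_ hmain
  rw [hTmax]
  push_cast
  calc ∑ u ∈ T, (costC E C u : ℝ) ≤ ∑ u ∈ T, ∑ v, g u v * (costC E D v : ℝ) :=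
        sum_le_sum fun u _ => hcost u
    _ = _ := by rw [sum_comm]; exact sum_congr rfl fun v _ => (sum_mul _ _ _).symm

theorem card_symmDiff_triangle {α : Type*} (s t r : Finset α) :
    (symmDiff s r).card ≤ (symmDiff s t).card + (symmDiff t r).card := by
  refine (card_le_card ?_).trans (card_union_le _ _)
  exact symmDiff_triangle s t r

theorem card_le_card_add_card_symmDiff {α : Type*} (s t : Finset α) :
    t.card ≤ s.card + (symmDiff s t).card := by
  refine (card_le_card ?_).trans (card_union_le _ _)
  intro x hx
  simp only [mem_union, mem_symmDiff]
  tauto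

theorem deg_pos [Fintype V] {E : V → V → Prop} (hrefl : ∀ u, E u u) (u : V) :
    (1 : ℝ) ≤ deg E u := by
  have : 0 < deg E u := card_pos.2 ⟨u, by simp [Nbr, hrefl]⟩
  exact_mod_cast this

theorem Mdeg_comm [Fintype V] (E : V → V → Prop) (u v : V) : Mdeg E u v = Mdeg E v u :=
  max_comm _ _

theorem deg_le_Mdeg_left [Fintype V] (E : V → V → Prop) (u v : V) :
    (deg E u : ℝ) ≤ Mdeg E u v := by
  exact_mod_cast le_max_left _ _

theorem deg_le_Mdeg_right [Fintype V] (E : V → V → Prop) (u v : V) :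
    (deg E v : ℝ) ≤ Mdeg E u v := by
  exact_mod_cast le_max_right _ _

theorem Mdeg_pos [Fintype V] {E : V → V → Prop} (hrefl : ∀ u, E u u) (u v : V) :
    (0 : ℝ) < Mdeg E u v := by
  linarith [deg_pos hrefl u, deg_le_Mdeg_left E u v]

theorem EH_refl [Fintype V] {β : ℝ} {E : V → V → Prop} (hβ0 : 0 < β) (hrefl : ∀ u, E u u)
    (u : V) : EH β E u u :=
  ⟨hrefl u, by simp only [symmDiff_self, bot_eq_empty, card_empty, Nat.cast_zero]; positivity⟩

theorem EH_symm [Fintype V] {β : ℝ} {E : V → V → Prop} (hsymm : ∀ u v, E u v → E v u)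
    {u v : V} (h : EH β E u v) : EH β E v u :=
  ⟨hsymm _ _ h.1, by rw [symmDiff_comm, Mdeg_comm]; exact h.2⟩

theorem EH_deg_le [Fintype V] {β : ℝ} {E : V → V → Prop} (hβ : β ≤ 3 / 64)
    {u v : V} (h : EH β E u v) : (deg E v : ℝ) ≤ 20 / 19 * deg E u := by
  have h1 : (deg E v : ℝ) ≤ deg E u + ((symmDiff (Nbr E u) (Nbr E v)).card : ℝ) := by
    exact_mod_cast card_le_card_add_card_symmDiff (Nbr E u) (Nbr E v)
  have h2 := h.2
  have hu : (0 : ℝ) ≤ deg E u := Nat.cast_nonneg _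
  have hv : (0 : ℝ) ≤ deg E v := Nat.cast_nonneg _
  have h3 : (Mdeg E u v : ℝ) = max (deg E u : ℝ) (deg E v : ℝ) := by
    simp [Mdeg]
  rw [h3] at h2
  rcases max_cases (deg E u : ℝ) (deg E v : ℝ) with ⟨h4, _⟩ | ⟨h4, _⟩ <;> rw [h4] at h2 <;>
    nlinarith

/-- Vertices joined by four steps in the pruned graph have similar neighborhoods. -/
theorem card_symmDiff_le_of_EH_chain [Fintype V] {β : ℝ} {E : V → V → Prop} (hβ0 : 0 < β)
    (hβ : β ≤ 3 / 64) (hsymm : ∀ u v, E u v → E v u) {a b c d e : V} (hab : EH β E a b)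
    (hbc : EH β E b c) (hcd : EH β E c d) (hde : EH β E d e) :
    ((symmDiff (Nbr E a) (Nbr E e)).card : ℝ) ≤ 5 * β * Mdeg E a e := by
  have hM0 : (0 : ℝ) ≤ Mdeg E a e := Nat.cast_nonneg _
  have ha := deg_le_Mdeg_left E a e
  have he := deg_le_Mdeg_right E a e
  have hb := EH_deg_le hβ hab
  have hc := EH_deg_le hβ hbc
  have hd := EH_deg_le hβ (EH_symm hsymm hde)
  have key : ∀ x y : V, ∀ r : ℝ, EH β E x y → (deg E x : ℝ) ≤ r * Mdeg E a e →
      (deg E y : ℝ) ≤ r * Mdeg E a e →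
      ((symmDiff (Nbr E x) (Nbr E y)).card : ℝ) ≤ β * (r * Mdeg E a e) := by
    intro x y r hxy hx hy
    refine hxy.2.trans (mul_le_mul_of_nonneg_left ?_ hβ0.le)
    simpa [Mdeg] using And.intro hx hy
  have k1 := key a b (20 / 19) hab (by linarith) (by linarith)
  have k2 := key b c (400 / 361) hbc (by linarith) (by linarith)
  have k3 := key c d (400 / 361) hcd (by linarith) (by linarith)
  have k4 := key d e (20 / 19) hde (by linarith) (by linarith)
  have t1 : ((symmDiff (Nbr E a) (Nbr E e)).card : ℝ) ≤
      (symmDiff (Nbr E a) (Nbr E b)).card + ((symmDiff (Nbr E b) (Nbr E c)).card +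
        ((symmDiff (Nbr E c) (Nbr E d)).card + (symmDiff (Nbr E d) (Nbr E e)).card)) := by
    have s1 := card_symmDiff_triangle (Nbr E a) (Nbr E b) (Nbr E e)
    have s2 := card_symmDiff_triangle (Nbr E b) (Nbr E c) (Nbr E e)
    have s3 := card_symmDiff_triangle (Nbr E c) (Nbr E d) (Nbr E e)
    exact_mod_cast s1.trans (by omega)
  have : 0 ≤ β * Mdeg E a e := by positivity
  linarith

theorem NH_subset_Nbr [Fintype V] (β : ℝ) (E : V → V → Prop) (u : V) : NH β E u ⊆ Nbr E u := by
  intro v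
  simp only [NH, Nbr, mem_filter, mem_univ, true_and]
  exact fun h => h.1

theorem card_union_inter_symmDiff {α : Type*} (s t : Finset α) :
    (s ∪ t).card = (s ∩ t).card + (symmDiff s t).card := by
  have hd : Disjoint (s ∩ t) (symmDiff s t) := by
    rw [disjoint_left]
    intro x
    simp only [mem_inter, mem_symmDiff]
    tauto
  rw [← card_union_of_disjoint hd]
  congr 1
  ext x
  simp only [mem_union, mem_inter, mem_symmDiff]
  tauto

/-- Two heavy vertices with similar neighborhoods have a common neighbor in `H`. -/
theorem NH_inter_nonempty [Fintype V] {β lam : ℝ} {E : V → V → Prop} (hrefl : ∀ u, E u u)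
    (hβ0 : 0 < β) (hβlam : 8 * β + lam ≤ 3 / 8) {g h : V} (hg : Heavy β lam E g)
    (hh : Heavy β lam E h)
    (hnear : ((symmDiff (Nbr E g) (Nbr E h)).card : ℝ) ≤ 5 * β * Mdeg E g h) :
    (NH β E g ∩ NH β E h).Nonempty := by
  rw [← card_pos]
  have h1 := card_union_add_card_inter (NH β E g) (NH β E h)
  have h2 := card_le_card (union_subset_union (NH_subset_Nbr β E g) (NH_subset_Nbr β E h))
  have h3 := card_union_add_card_inter (Nbr E g) (Nbr E h)
  have h4 := card_union_inter_symmDiff (Nbr E g) (Nbr E h)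
  have h5 : (2 * ((NH β E g).card + (NH β E h).card : ℝ)) ≤
      2 * ((NH β E g ∩ NH β E h).card : ℝ) + deg E g + deg E h +
        (symmDiff (Nbr E g) (Nbr E h)).card := by
    unfold deg
    have : 2 * ((NH β E g).card + (NH β E h).card) ≤
      2 * (NH β E g ∩ NH β E h).card + (Nbr E g).card + (Nbr E h).card +
        (symmDiff (Nbr E g) (Nbr E h)).card := by omega
    exact_mod_cast this
  have hM : (Mdeg E g h : ℝ) ≤ deg E g + deg E h := by
    unfold Mdeg
    exact_mod_cast max_le (Nat.le_add_right _ _) (Nat.le_add_left _ _)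
  unfold Heavy dH at hg hh
  have hd1 := deg_pos hrefl g
  have hd2 := deg_pos hrefl h
  have : (0 : ℝ) < ((NH β E g ∩ NH β E h).card : ℝ) := by nlinarith
  exact_mod_cast this

theorem Gtilde_adj [Fintype V] {β lam : ℝ} {E : V → V → Prop}
    (hsymm : ∀ u v, E u v → E v u) {u v : V} (h : (Gtilde β lam E).Adj u v) :
    EH β E u v ∧ (Heavy β lam E u ∨ Heavy β lam E v) := by
  rw [Gtilde, SimpleGraph.fromRel_adj] at h
  rcases h.2 with h | h
  · exact h
  · exact ⟨EH_symm hsymm h.1, h.2.symm⟩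

theorem mem_NH [Fintype V] {β : ℝ} {E : V → V → Prop} {u v : V} : v ∈ NH β E u ↔ EH β E u v := by
  simp [NH]

/-- Every vertex connected to a heavy vertex `h` in `G̃` has a heavy `H`-neighbor sharing an
`H`-neighbor with `h`. -/
theorem exists_heavy_of_reachable [Fintype V] {β lam : ℝ} {E : V → V → Prop}
    (hsymm : ∀ u v, E u v → E v u) (hrefl : ∀ u, E u u) (hβ0 : 0 < β) (hlam0 : 0 < lam)
    (hβlam : 8 * β + lam ≤ 3 / 8) {h v : V} (hh : Heavy β lam E h)
    (hr : (Gtilde β lam E).Reachable v h) :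
    ∃ g w, Heavy β lam E g ∧ EH β E v g ∧ EH β E g w ∧ EH β E w h := by
  have hβ : β ≤ 3 / 64 := by linarith
  have common : ∀ {a b c d : V}, Heavy β lam E a → Heavy β lam E h → EH β E a b →
      EH β E b c → EH β E c d → EH β E d h → ∃ w, EH β E a w ∧ EH β E w h := by
    intro a b c d ha hh h1 h2 h3 h4
    obtain ⟨w, hw⟩ := NH_inter_nonempty hrefl hβ0 hβlam ha hh
      (card_symmDiff_le_of_EH_chain hβ0 hβ hsymm h1 h2 h3 h4)
    rw [mem_inter, mem_NH, mem_NH] at hw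
    exact ⟨w, hw.1, EH_symm hsymm hw.2⟩
  obtain ⟨p⟩ := hr
  induction p with
  | nil => exact ⟨_, _, hh, EH_refl hβ0 hrefl _, EH_refl hβ0 hrefl _, EH_refl hβ0 hrefl _⟩
  | @cons u v h hadj p ih =>
    obtain ⟨g, w, hg, hvg, hgw, hwh⟩ := ih hh common
    obtain ⟨huv, hu | hv⟩ := Gtilde_adj hsymm hadj
    · obtain ⟨x, hx1, hx2⟩ := common hu hh huv hvg hgw hwh
      exact ⟨u, x, hu, EH_refl hβ0 hrefl _, hx1, hx2⟩
    · obtain ⟨x, hx1, hx2⟩ := common hv hh (EH_refl hβ0 hrefl v) hvg hgw hwh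
      exact ⟨v, x, hv, huv, hx1, hx2⟩

theorem exists_heavy_of_preCluster_eq [Fintype V] {β lam : ℝ} {E : V → V → Prop}
    (hsymm : ∀ u v, E u v → E v u) (hrefl : ∀ u, E u u) (hβ0 : 0 < β) {u v : V} (huv : v ≠ u)
    (h : preCluster β lam E u = preCluster β lam E v) :
    ∃ g, Heavy β lam E g ∧ EH β E u g ∧ preCluster β lam E u = preCluster β lam E g := by
  obtain ⟨p⟩ := SimpleGraph.ConnectedComponent.exact h
  cases p with
  | nil => exact absurd rfl huv
  | @cons _ x _ hadj p =>
    obtain ⟨hux, hu | hx⟩ := Gtilde_adj hsymm hadj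
    · exact ⟨u, hu, EH_refl hβ0 hrefl _, rfl⟩
    · exact ⟨x, hx, hux, SimpleGraph.ConnectedComponent.sound hadj.reachable⟩

/-- Vertices of the same pre-cluster have similar neighborhoods. -/
theorem card_symmDiff_le_of_preCluster_eq [Fintype V] {β lam : ℝ} {E : V → V → Prop}
    (hsymm : ∀ u v, E u v → E v u) (hrefl : ∀ u, E u u) (hβ0 : 0 < β) (hlam0 : 0 < lam)
    (hβlam : 8 * β + lam ≤ 3 / 8) {u v : V}
    (h : preCluster β lam E u = preCluster β lam E v) :
    ((symmDiff (Nbr E u) (Nbr E v)).card : ℝ) ≤ 5 * β * Mdeg E u v := by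
  by_cases huv : v = u
  · subst huv
    simp only [symmDiff_self, bot_eq_empty, card_empty, Nat.cast_zero]
    positivity
  obtain ⟨g, hg, hug, hgc⟩ := exists_heavy_of_preCluster_eq hsymm hrefl hβ0 huv h
  obtain ⟨x, w, -, hvx, hxw, hwg⟩ := exists_heavy_of_reachable hsymm hrefl hβ0 hlam0 hβlam hg
    (SimpleGraph.ConnectedComponent.exact (h.symm.trans hgc))
  exact card_symmDiff_le_of_EH_chain hβ0 (by linarith) hsymm hug (EH_symm hsymm hwg)
    (EH_symm hsymm hxw) (EH_symm hsymm hvx)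

theorem Mdeg_eq_max [Fintype V] (E : V → V → Prop) (u v : V) :
    (Mdeg E u v : ℝ) = max (deg E u : ℝ) (deg E v : ℝ) := by
  simp [Mdeg]

theorem card_inter_ge_of_preCluster_eq [Fintype V] {β lam : ℝ} {E : V → V → Prop}
    (hsymm : ∀ u v, E u v → E v u) (hrefl : ∀ u, E u u) (hβ0 : 0 < β) (hlam0 : 0 < lam)
    (hβlam : 8 * β + lam ≤ 3 / 8) {u v : V}
    (h : preCluster β lam E u = preCluster β lam E v) :
    3 / 4 * (Mdeg E u v : ℝ) ≤ ((Nbr E u ∩ Nbr E v).card : ℝ) := by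
  have h1 := card_symmDiff_le_of_preCluster_eq hsymm hrefl hβ0 hlam0 hβlam h
  have h2 : ((Nbr E u ∪ Nbr E v).card : ℝ) = (Nbr E u ∩ Nbr E v).card +
      (symmDiff (Nbr E u) (Nbr E v)).card := by
    exact_mod_cast card_union_inter_symmDiff _ _
  have h3 : (Mdeg E u v : ℝ) ≤ (Nbr E u ∪ Nbr E v).card := by
    unfold Mdeg deg
    exact_mod_cast max_le (card_le_card subset_union_left) (card_le_card subset_union_right)
  have h4 := Mdeg_pos hrefl u v
  nlinarith

/-- A pre-cluster with at least two vertices is not much larger than the degree of its vertices. -/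
theorem card_preCluster_le [Fintype V] {β lam : ℝ} {E : V → V → Prop}
    (hsymm : ∀ u v, E u v → E v u) (hrefl : ∀ u, E u u) (hβ0 : 0 < β) (hlam0 : 0 < lam)
    (hβlam : 8 * β + lam ≤ 3 / 8) {u v : V} (huv : v ≠ u)
    (h : preCluster β lam E u = preCluster β lam E v) :
    ((univ.filter fun x => preCluster β lam E u = preCluster β lam E x).card : ℝ) ≤
      9 / 4 * deg E u := by
  have hβ : β ≤ 3 / 64 := by linarith
  obtain ⟨g, hg, hug, hgc⟩ := exists_heavy_of_preCluster_eq hsymm hrefl hβ0 huv h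
  set K := univ.filter fun x => preCluster β lam E u = preCluster β lam E x with hK
  have hgpos := deg_pos hrefl g
  have hgu := EH_deg_le hβ hug
  have hlow : ∀ x ∈ K, 5 / 8 * (deg E g : ℝ) ≤ ((NH β E g).filter (fun y => E x y)).card := by
    intro x hx
    have hx' : preCluster β lam E g = preCluster β lam E x :=
      hgc.symm.trans (mem_filter.1 hx).2
    have hnear := card_symmDiff_le_of_preCluster_eq hsymm hrefl hβ0 hlam0 hβlam hx'
    have hdx : (deg E x : ℝ) ≤ deg E g + ((symmDiff (Nbr E g) (Nbr E x)).card : ℝ) := by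
      exact_mod_cast card_le_card_add_card_symmDiff (Nbr E g) (Nbr E x)
    have hsd : ((symmDiff (Nbr E g) (Nbr E x)).card : ℝ) ≤ 8 * β * deg E g := by
      rw [Mdeg_eq_max] at hnear
      rcases max_cases (deg E g : ℝ) (deg E x : ℝ) with ⟨h4, _⟩ | ⟨h4, _⟩ <;> rw [h4] at hnear
      · nlinarith
      · have h5 : (deg E x : ℝ) ≤ 8 / 5 * deg E g := by nlinarith
        nlinarith
    have hsub : NH β E g ⊆ (NH β E g).filter (fun y => E x y) ∪
        symmDiff (Nbr E g) (Nbr E x) := by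
      intro y hy
      have hy' := NH_subset_Nbr β E g hy
      rw [mem_union, mem_filter, mem_symmDiff]
      by_cases hxy : E x y
      · exact Or.inl ⟨hy, hxy⟩
      · exact Or.inr (Or.inl ⟨hy', by simpa [Nbr] using hxy⟩)
    have h6 : ((NH β E g).card : ℝ) ≤ ((NH β E g).filter (fun y => E x y)).card +
        (symmDiff (Nbr E g) (Nbr E x)).card := by
      exact_mod_cast (card_le_card hsub).trans (card_union_le _ _)
    unfold Heavy dH at hg
    nlinarith
  have hup : ∀ y ∈ NH β E g, ((K.filter (fun x => E x y)).card : ℝ) ≤ 20 / 19 * deg E g := by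
    intro y hy
    refine le_trans ?_ (EH_deg_le hβ (mem_NH.1 hy))
    unfold deg
    refine Nat.cast_le.2 (card_le_card ?_)
    intro x hx
    simpa [Nbr] using hsymm _ _ (mem_filter.1 hx).2
  have hdc := sum_card_bipartiteAbove_eq_sum_card_bipartiteBelow (s := K) (t := NH β E g)
    (fun x y => E x y)
  unfold bipartiteAbove bipartiteBelow at hdc
  have hdc' : ∑ x ∈ K, (((NH β E g).filter (fun y => E x y)).card : ℝ) =
      ∑ y ∈ NH β E g, ((K.filter (fun x => E x y)).card : ℝ) := by exact_mod_cast hdc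
  have s1 := card_nsmul_le_sum K _ _ hlow
  have s2 := sum_le_card_nsmul (NH β E g) _ _ hup
  rw [nsmul_eq_mul] at s1 s2
  have hNg : ((NH β E g).card : ℝ) ≤ deg E g := by
    exact_mod_cast card_le_card (NH_subset_Nbr β E g)
  have s3 : (K.card : ℝ) * (5 / 8 * deg E g) ≤ (20 / 19 * deg E g) * deg E g := by
    calc _ ≤ _ := s1
      _ = _ := hdc'
      _ ≤ _ := s2
      _ ≤ deg E g * (20 / 19 * deg E g) := mul_le_mul_of_nonneg_right hNg (by positivity)
      _ = _ := mul_comm _ _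
  have s4 : (K.card : ℝ) * (5 / 8) ≤ 20 / 19 * deg E g := by
    refine le_of_mul_le_mul_right ?_ (by linarith : (0 : ℝ) < deg E g)
    linarith
  linarith

theorem card_cut_le_costC [Fintype V] {α : Type*} (E : V → V → Prop) (D : V → α) (u : V) :
    (univ.filter fun v => E u v ∧ D u ≠ D v).card ≤ costC E D u := by
  refine card_le_card fun v => ?_
  simp only [mem_filter, mem_univ, true_and]
  exact Or.inl

theorem card_symmDiff_le_costC [Fintype V] {α : Type*} {E : V → V → Prop}
    (hrefl : ∀ u, E u u) (D : V → α) {u v : V} (hD : D u = D v) :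
    (symmDiff (Nbr E u) (Nbr E v)).card ≤ costC E D u + costC E D v := by
  refine (card_le_card ?_).trans (card_union_le _ _)
  intro w
  simp only [mem_symmDiff, Nbr, mem_filter, mem_univ, true_and, mem_union, ← hD]
  have h1 : w = u → E u w := by rintro rfl; exact hrefl _
  have h2 : w = v → E v w := by rintro rfl; exact hrefl _
  tauto

theorem card_inter_le_costC [Fintype V] {α : Type*} {E : V → V → Prop} (D : V → α) {u v : V}
    (hD : D u ≠ D v) :
    (Nbr E u ∩ Nbr E v).card ≤ costC E D u + costC E D v := by
  refine (card_le_card ?_).trans (card_union_le _ _)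
  intro w
  simp only [mem_inter, Nbr, mem_filter, mem_univ, true_and, mem_union]
  rintro ⟨h1, h2⟩
  by_cases h : D u = D w
  · exact Or.inr (Or.inl ⟨h2, fun h' => hD (h.trans h'.symm)⟩)
  · exact Or.inl (Or.inl ⟨h1, h⟩)

theorem sum_Nbr_inv_Mdeg_le_one [Fintype V] {E : V → V → Prop} (hrefl : ∀ u, E u u) (u : V) :
    ∑ v, (if E u v then 1 / (Mdeg E u v : ℝ) else 0) ≤ 1 := by
  rw [← sum_filter]
  have hd := deg_pos hrefl u
  calc ∑ v ∈ univ.filter (fun v => E u v), 1 / (Mdeg E u v : ℝ)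
      ≤ ∑ v ∈ univ.filter (fun v => E u v), 1 / (deg E u : ℝ) :=
        sum_le_sum fun v _ => one_div_le_one_div_of_le (by linarith) (deg_le_Mdeg_left E u v)
    _ = (deg E u : ℝ) * (1 / deg E u) := by rw [sum_const, nsmul_eq_mul]; rfl
    _ ≤ 1 := by rw [mul_one_div_cancel (by linarith)]

theorem sum_Nbr_inv_Mdeg_le_one' [Fintype V] {E : V → V → Prop}
    (hsymm : ∀ u v, E u v → E v u) (hrefl : ∀ u, E u u) (v : V) :
    ∑ u, (if E u v then 1 / (Mdeg E u v : ℝ) else 0) ≤ 1 := by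
  refine le_trans (le_of_eq ?_) (sum_Nbr_inv_Mdeg_le_one hrefl v)
  refine sum_congr rfl fun u _ => ?_
  rw [Mdeg_comm]
  exact if_congr ⟨hsymm _ _, hsymm _ _⟩ rfl rfl

/-- Charging the `-`edges inside the pre-clusters. -/
theorem exists_charging_inner [Fintype V] {β lam : ℝ} {E : V → V → Prop}
    (hsymm : ∀ u v, E u v → E v u) (hrefl : ∀ u, E u u) (hβ0 : 0 < β) (hlam0 : 0 < lam)
    (hβlam : 8 * β + lam ≤ 3 / 8) {α : Type*} (D : V → α) :
    ∃ g : V → V → ℝ, (∀ u v, 0 ≤ g u v) ∧ (∀ u, ∑ v, g u v ≤ 7) ∧ (∀ v, ∑ u, g u v ≤ 7) ∧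
      ∀ u, ((univ.filter fun v => ¬ E u v ∧ v ≠ u ∧
        preCluster β lam E u = preCluster β lam E v).card : ℝ) ≤
          ∑ v, g u v * (costC E D v : ℝ) := by
  set R : V → V → Prop := fun u v => ¬ E u v ∧ v ≠ u ∧
    preCluster β lam E u = preCluster β lam E v with hR
  set o : V → V → ℝ := fun u v => if R u v then 4 / 3 * (1 / (Mdeg E u v : ℝ)) else 0 with ho
  have hRsymm : ∀ u v, R u v → R v u := fun u v h =>
    ⟨fun h' => h.1 (hsymm _ _ h'), h.2.1.symm, h.2.2.symm⟩
  have ho0 : ∀ u v, 0 ≤ o u v := by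
    intro u v
    simp only [ho]
    split_ifs
    · positivity
    · exact le_rfl
  have horow : ∀ u, ∑ v, o u v ≤ 3 := by
    intro u
    have hd := deg_pos hrefl u
    simp only [ho]
    rw [← sum_filter]
    rcases (univ.filter (R u)).eq_empty_or_nonempty with he | ⟨v, hv⟩
    · rw [he, sum_empty]; norm_num
    have hv' := (mem_filter.1 hv).2
    have hcard := card_preCluster_le hsymm hrefl hβ0 hlam0 hβlam hv'.2.1 hv'.2.2
    have hle : ((univ.filter (R u)).card : ℝ) ≤ 9 / 4 * deg E u := by
      refine le_trans ?_ hcard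
      refine Nat.cast_le.2 (card_le_card fun x => ?_)
      simp only [mem_filter, mem_univ, true_and]
      exact fun h => h.2.2
    calc ∑ v ∈ univ.filter (R u), 4 / 3 * (1 / (Mdeg E u v : ℝ))
        ≤ ∑ v ∈ univ.filter (R u), 4 / 3 * (1 / (deg E u : ℝ)) :=
          sum_le_sum fun v _ => mul_le_mul_of_nonneg_left
            (one_div_le_one_div_of_le (by linarith) (deg_le_Mdeg_left E u v)) (by norm_num)
      _ = ((univ.filter (R u)).card : ℝ) * (4 / 3 * (1 / deg E u)) := by
          rw [sum_const, nsmul_eq_mul]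
      _ ≤ (9 / 4 * deg E u) * (4 / 3 * (1 / deg E u)) :=
          mul_le_mul_of_nonneg_right hle (by positivity)
      _ = 3 := by field_simp; norm_num
  have hosymm : ∀ u v, o u v = o v u := by
    intro u v
    simp only [ho]
    rw [Mdeg_comm]
    exact if_congr ⟨hRsymm _ _, hRsymm _ _⟩ rfl rfl
  refine ⟨fun u v => (if v = u then 4 else 0) + o u v, ?_, ?_, ?_, ?_⟩
  · intro u v
    have := ho0 u v
    positivity
  · intro u
    rw [sum_add_distrib, sum_ite_eq' univ u]
    simp only [mem_univ, if_true]
    linarith [horow u]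
  · intro v
    rw [sum_add_distrib, sum_ite_eq univ v]
    simp only [mem_univ, if_true]
    simp only [fun u => hosymm u v]
    linarith [horow v]
  · intro u
    simp only [add_mul, ite_mul, zero_mul]
    rw [sum_add_distrib, sum_ite_eq' univ u]
    simp only [mem_univ, if_true]
    have hpt : ∀ v, (if R u v then (1 : ℝ) else 0) ≤
        (if ¬ E u v ∧ v ≠ u ∧ D u = D v then 1 else 0) +
          (o u v * costC E D u + o u v * costC E D v) := by
      intro v
      have h0 := ho0 u v
      split_ifs with h1 h2 h2
      · have : 0 ≤ o u v * costC E D u + o u v * costC E D v := by positivity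
        linarith
      · have hD : D u ≠ D v := fun h => h2 ⟨h1.1, h1.2.1, h⟩
        have h3 := card_inter_ge_of_preCluster_eq hsymm hrefl hβ0 hlam0 hβlam h1.2.2
        have h4 : ((Nbr E u ∩ Nbr E v).card : ℝ) ≤ costC E D u + costC E D v := by
          exact_mod_cast card_inter_le_costC D hD
        have hM := Mdeg_pos hrefl u v
        have h5 : o u v = 4 / 3 * (1 / (Mdeg E u v : ℝ)) := if_pos h1
        rw [← mul_add, h5, zero_add]
        calc (1 : ℝ) = 4 / 3 * (1 / (Mdeg E u v : ℝ)) * (3 / 4 * Mdeg E u v) := by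
              field_simp
          _ ≤ _ := mul_le_mul_of_nonneg_left (h3.trans h4) (by positivity)
      · positivity
      · positivity
    have h6 := sum_le_sum (s := (univ : Finset V)) fun v _ => hpt v
    rw [sum_add_distrib, sum_add_distrib, sum_boole, sum_boole, ← sum_mul] at h6
    have h7 : ((univ.filter fun v => ¬ E u v ∧ v ≠ u ∧ D u = D v).card : ℝ) ≤ costC E D u := by
      refine Nat.cast_le.2 (card_le_card fun v => ?_)
      simp only [mem_filter, mem_univ, true_and]
      exact Or.inr
    have h8 : (∑ v, o u v) * costC E D u ≤ 3 * costC E D u :=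
      mul_le_mul_of_nonneg_right (horow u) (Nat.cast_nonneg _)
    linarith

theorem card_cut_preCluster_le_of_heavy [Fintype V] {β lam : ℝ} {E : V → V → Prop} {u : V}
    (hu : Heavy β lam E u) :
    (univ.filter fun v => E u v ∧ preCluster β lam E u ≠ preCluster β lam E v).card ≤
      (univ.filter fun v => E u v ∧ ¬ EH β E u v).card := by
  refine card_le_card fun v => ?_
  simp only [mem_filter, mem_univ, true_and]
  refine fun h => ⟨h.1, fun hEH => h.2 ?_⟩
  by_cases huv : u = v
  · rw [huv]
  · refine SimpleGraph.ConnectedComponent.sound (SimpleGraph.Adj.reachable ?_)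
    rw [Gtilde, SimpleGraph.fromRel_adj]
    exact ⟨huv, Or.inl ⟨hEH, Or.inl hu⟩⟩

theorem lam_mul_deg_le_of_not_heavy [Fintype V] {β lam : ℝ} {E : V → V → Prop} {u : V}
    (hu : ¬ Heavy β lam E u) :
    lam * deg E u ≤ ((univ.filter fun v => E u v ∧ ¬ EH β E u v).card : ℝ) := by
  have h1 : deg E u ≤ dH β E u + (univ.filter fun v => E u v ∧ ¬ EH β E u v).card := by
    refine (card_le_card ?_).trans (card_union_le _ _)
    intro v
    simp only [Nbr, NH, mem_union, mem_filter, mem_univ, true_and]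
    tauto
  have h2 : (deg E u : ℝ) ≤ dH β E u + ((univ.filter fun v => E u v ∧ ¬ EH β E u v).card : ℝ) := by
    exact_mod_cast h1
  unfold Heavy at hu
  linarith

/-- Charging the `+`edges between the pre-clusters. -/
theorem exists_charging_cut [Fintype V] {β lam : ℝ} {E : V → V → Prop}
    (hsymm : ∀ u v, E u v → E v u) (hrefl : ∀ u, E u u) (hβ0 : 0 < β) (hlam0 : 0 < lam)
    (hlam1 : lam < 1) {α : Type*} (D : V → α) :
    ∃ g : V → V → ℝ, (∀ u v, 0 ≤ g u v) ∧
      (∀ u, ∑ v, g u v ≤ 3 / β + 1 / lam + 1 / (β * lam) + 1) ∧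
      (∀ v, ∑ u, g u v ≤ 3 / β + 1 / lam + 1 / (β * lam) + 1) ∧
      ∀ u, ((univ.filter fun v => E u v ∧
        preCluster β lam E u ≠ preCluster β lam E v).card : ℝ) ≤
          ∑ v, g u v * (costC E D v : ℝ) := by
  set c : V → ℝ := fun u => (costC E D u : ℝ) with hc
  have hc0 : ∀ u, 0 ≤ c u := fun u => Nat.cast_nonneg _
  set H : V → Prop := fun u => Heavy β lam E u with hH
  set p : ℝ := 1 / (β * lam) + 1 / β with hp
  have hib : 0 < 1 / β := by positivity
  have hil : 0 < 1 / lam := by positivity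
  have hibl : 0 < 1 / (β * lam) := by positivity
  have hp0 : 0 < p := by positivity
  have h3b : 3 / β = 3 * (1 / β) := by ring
  have hpθ : p * (β * lam) = 1 + lam := by rw [hp]; field_simp
  have hpθ' : lam * p * β = 1 + lam := by linarith
  -- below the threshold `(1 + lam) * c u < β * lam * d(u)` the cost of `u` is negligible
  set low : V → Prop := fun u => ¬ H u ∧ (1 + lam) * c u < β * lam * deg E u with hlow
  set o : V → V → ℝ := fun u v =>
    if E u v ∧ H u then 1 / β * (1 / (Mdeg E u v : ℝ))
    else if E u v ∧ low u ∧ β * Mdeg E u v ≤ (1 + lam) * c v then p * (1 / (Mdeg E u v : ℝ))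
    else 0 with ho
  set s : V → ℝ := fun u =>
    if H u then 1 + 1 / β else if low u then 1 / lam else deg E u / c u with hs
  have hbad : ∀ u v, E u v → ¬ EH β E u v → D u = D v → β * Mdeg E u v ≤ c u + c v := by
    intro u v huv hEH hD
    have h1 : β * Mdeg E u v < ((symmDiff (Nbr E u) (Nbr E v)).card : ℝ) := by
      by_contra h
      exact hEH ⟨huv, not_lt.1 h⟩
    have h2 : ((symmDiff (Nbr E u) (Nbr E v)).card : ℝ) ≤ c u + c v := by
      simp only [hc]
      exact_mod_cast card_symmDiff_le_costC hrefl D hD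
    linarith
  have hcut : ∀ u, ((univ.filter fun v => E u v ∧ D u ≠ D v).card : ℝ) ≤ c u := fun u =>
    Nat.cast_le.2 (card_cut_le_costC E D u)
  have hM : ∀ u v, (0 : ℝ) < Mdeg E u v := Mdeg_pos hrefl
  have ho0 : ∀ u v, 0 ≤ o u v := by
    intro u v
    have := hM u v
    simp only [ho]
    split_ifs <;> positivity
  have hs0 : ∀ u, 0 ≤ s u := by
    intro u
    have := hc0 u
    simp only [hs]
    split_ifs <;> positivity
  have hop : ∀ u v, o u v ≤ p * (if E u v then 1 / (Mdeg E u v : ℝ) else 0) := by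
    intro u v
    have hMi : 0 < 1 / (Mdeg E u v : ℝ) := one_div_pos.2 (hM u v)
    simp only [ho]
    split_ifs with h1 h2 h3 h4 h5
    · exact mul_le_mul_of_nonneg_right (by linarith) hMi.le
    · exact absurd h1.1 h2
    · exact le_rfl
    · exact absurd h3.1 h4
    · positivity
    · simp
  have hob : ∀ u v, (H u ∨ ¬ (E u v ∧ low u ∧ β * Mdeg E u v ≤ (1 + lam) * c v)) →
      o u v ≤ 1 / β * (if E u v then 1 / (Mdeg E u v : ℝ) else 0) := by
    intro u v hor
    have hMi : 0 < 1 / (Mdeg E u v : ℝ) := one_div_pos.2 (hM u v)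
    simp only [ho]
    split_ifs with h1 h2 h3 h4 h5
    · exact le_rfl
    · exact absurd h1.1 h2
    · exact absurd h3 (hor.resolve_left h3.2.1.1)
    · exact absurd h3.1 h4
    · positivity
    · simp
  have hhigh : ∀ u, ¬ H u → ¬ low u → β * lam * deg E u ≤ (1 + lam) * c u ∧ 0 < c u := by
    intro u h1 h2
    have h3 : β * lam * deg E u ≤ (1 + lam) * c u := by
      by_contra h
      exact h2 ⟨h1, not_le.1 h⟩
    have hd := deg_pos hrefl u
    have h4 : 0 < β * lam * deg E u := by positivity
    exact ⟨h3, by nlinarith⟩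
  have hshigh : ∀ u, ¬ H u → ¬ low u → s u ≤ p := by
    intro u h1 h2
    obtain ⟨h3, h4⟩ := hhigh u h1 h2
    simp only [hs]
    rw [if_neg h1, if_neg h2, div_le_iff₀ h4]
    have h5 : 0 < β * lam := by positivity
    refine le_of_mul_le_mul_right ?_ h5
    nlinarith
  refine ⟨fun u v => (if v = u then s u else 0) + o u v, ?_, ?_, ?_, ?_⟩
  · intro u v
    have h1 := ho0 u v
    have h2 := hs0 u
    positivity
  · intro u
    rw [sum_add_distrib, sum_ite_eq' univ u]
    simp only [mem_univ, if_true]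
    have hone := sum_Nbr_inv_Mdeg_le_one hrefl u
    have h2 : ∑ v, o u v ≤ p := by
      refine (sum_le_sum fun v _ => hop u v).trans ?_
      rw [← mul_sum]
      nlinarith
    by_cases h1 : H u
    · have h3 : s u = 1 + 1 / β := if_pos h1
      linarith
    by_cases h4 : low u
    · have h3 : s u = 1 / lam := by simp only [hs]; rw [if_neg h1, if_pos h4]
      linarith
    · have h3 := hshigh u h1 h4
      have h5 : ∑ v, o u v ≤ 1 / β := by
        refine (sum_le_sum fun v _ => hob u v (Or.inr fun h => h4 h.2.1)).trans ?_
        rw [← mul_sum]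
        nlinarith
      linarith
  · intro v
    rw [sum_add_distrib]
    simp only [sum_ite_eq, mem_univ, if_true]
    have hone := sum_Nbr_inv_Mdeg_le_one' hsymm hrefl v
    have h2 : ∑ u, o u v ≤ p := by
      refine (sum_le_sum fun u _ => hop u v).trans ?_
      rw [← mul_sum]
      nlinarith
    by_cases h1 : H v
    · have h3 : s v = 1 + 1 / β := if_pos h1
      linarith
    by_cases h4 : low v
    · have h3 : s v = 1 / lam := by simp only [hs]; rw [if_neg h1, if_pos h4]
      linarith
    by_cases h5 : ∃ u, E u v ∧ low u ∧ β * Mdeg E u v ≤ (1 + lam) * c v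
    · obtain ⟨u, -, -, h6⟩ := h5
      have h7 := deg_le_Mdeg_right E u v
      have h8 := (hhigh v h1 h4).2
      have h9 : s v ≤ 2 * (1 / β) := by
        simp only [hs]
        rw [if_neg h1, if_neg h4, div_le_iff₀ h8]
        refine le_of_mul_le_mul_left ?_ hβ0
        have : β * (2 * (1 / β) * c v) = 2 * c v := by field_simp
        rw [this]
        nlinarith
      linarith
    · push Not at h5
      have h6 : ∑ u, o u v ≤ 1 / β := by
        refine (sum_le_sum fun u _ => hob u v (Or.inr fun h => ?_)).trans ?_
        · exact absurd h.2.2 (not_le.2 (h5 u h.1 h.2.1))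
        · rw [← mul_sum]
          nlinarith
      have h3 := hshigh v h1 h4
      linarith
  · intro u
    simp only [add_mul, ite_mul, zero_mul]
    rw [sum_add_distrib, sum_ite_eq' univ u]
    simp only [mem_univ, if_true]
    change _ ≤ s u * c u + ∑ v, o u v * c v
    have hone := sum_Nbr_inv_Mdeg_le_one hrefl u
    have hdeg : ((univ.filter fun v => E u v ∧
        preCluster β lam E u ≠ preCluster β lam E v).card : ℝ) ≤ deg E u := by
      refine Nat.cast_le.2 (card_le_card fun v => ?_)
      simp only [Nbr, mem_filter, mem_univ, true_and]
      exact fun h => h.1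
    by_cases h1 : H u
    · have h3 : s u = 1 + 1 / β := if_pos h1
      have h4 : ((univ.filter fun v => E u v ∧
          preCluster β lam E u ≠ preCluster β lam E v).card : ℝ) ≤
          ((univ.filter fun v => E u v ∧ ¬ EH β E u v).card : ℝ) :=
        Nat.cast_le.2 (card_cut_preCluster_le_of_heavy h1)
      have hpt : ∀ v, (if E u v ∧ ¬ EH β E u v then (1 : ℝ) else 0) ≤
          (if E u v ∧ D u ≠ D v then 1 else 0) +
            ((if E u v then 1 / (Mdeg E u v : ℝ) else 0) * (1 / β * c u) + o u v * c v) := by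
        intro v
        have hnn : 0 ≤ (if E u v then 1 / (Mdeg E u v : ℝ) else 0) * (1 / β * c u) +
            o u v * c v := by
          have := hM u v
          have := hc0 u
          have := hc0 v
          have := ho0 u v
          split_ifs <;> positivity
        by_cases h5 : E u v ∧ ¬ EH β E u v
        · rw [if_pos h5]
          by_cases h6 : D u = D v
          · have h7 := hbad u v h5.1 h5.2 h6
            have h8 : o u v = 1 / β * (1 / (Mdeg E u v : ℝ)) := if_pos ⟨h5.1, h1⟩
            rw [if_neg (fun h => h.2 h6), if_pos h5.1, h8]
            have hMv := hM u v
            calc (1 : ℝ) = 1 / β * (1 / (Mdeg E u v : ℝ)) * (β * Mdeg E u v) := by field_simp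
              _ ≤ 1 / β * (1 / (Mdeg E u v : ℝ)) * (c u + c v) :=
                mul_le_mul_of_nonneg_left h7 (by positivity)
              _ = _ := by ring
          · rw [if_pos ⟨h5.1, h6⟩]
            linarith
        · rw [if_neg h5]
          have : (0 : ℝ) ≤ if E u v ∧ D u ≠ D v then 1 else 0 := by split_ifs <;> norm_num
          linarith
      have h6 := sum_le_sum (s := (univ : Finset V)) fun v _ => hpt v
      rw [sum_add_distrib, sum_add_distrib, sum_boole, sum_boole, ← sum_mul] at h6
      have h7 : (∑ v, (if E u v then 1 / (Mdeg E u v : ℝ) else 0)) * (1 / β * c u) ≤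
          1 * (1 / β * c u) := mul_le_mul_of_nonneg_right hone (mul_nonneg hib.le (hc0 u))
      have := hcut u
      rw [h3]
      linarith
    by_cases h2 : low u
    · have h3 : s u = 1 / lam := by simp only [hs]; rw [if_neg h1, if_pos h2]
      have h4 := lam_mul_deg_le_of_not_heavy h1
      have hpt : ∀ v, (if E u v ∧ ¬ EH β E u v then (1 : ℝ) else 0) ≤
          (if E u v ∧ D u ≠ D v then 1 else 0) + lam * (o u v * c v) := by
        intro v
        have hnn : 0 ≤ lam * (o u v * c v) :=
          mul_nonneg hlam0.le (mul_nonneg (ho0 u v) (hc0 v))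
        by_cases h5 : E u v ∧ ¬ EH β E u v
        · rw [if_pos h5]
          by_cases h6 : D u = D v
          · have h7 := hbad u v h5.1 h5.2 h6
            have hMu := deg_le_Mdeg_left E u v
            have h9 : β * Mdeg E u v ≤ (1 + lam) * c v := by
              have h10 : β * lam * deg E u ≤ β * lam * Mdeg E u v :=
                mul_le_mul_of_nonneg_left hMu (by positivity)
              have h11 := h2.2
              have h12 := mul_le_mul_of_nonneg_left h7 (by linarith : (0 : ℝ) ≤ 1 + lam)
              linarith
            have h8 : o u v = p * (1 / (Mdeg E u v : ℝ)) := by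
              simp only [ho]
              rw [if_neg (fun h => h1 h.2), if_pos ⟨h5.1, h2, h9⟩]
            rw [if_neg (fun h => h.2 h6), h8, zero_add]
            have hMv := hM u v
            have h13 : 0 < 1 + lam := by linarith
            refine le_of_mul_le_mul_left ?_ h13
            calc (1 + lam) * 1 = lam * p * β := by linarith
              _ = lam * p * (1 / (Mdeg E u v : ℝ)) * (β * Mdeg E u v) := by field_simp
              _ ≤ lam * p * (1 / (Mdeg E u v : ℝ)) * ((1 + lam) * c v) :=
                mul_le_mul_of_nonneg_left h9 (by positivity)
              _ = _ := by ring
          · rw [if_pos ⟨h5.1, h6⟩]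
            linarith
        · rw [if_neg h5]
          have : (0 : ℝ) ≤ if E u v ∧ D u ≠ D v then 1 else 0 := by split_ifs <;> norm_num
          linarith
      have h6 := sum_le_sum (s := (univ : Finset V)) fun v _ => hpt v
      rw [sum_add_distrib, sum_boole, sum_boole, ← mul_sum] at h6
      have := hcut u
      rw [h3]
      refine hdeg.trans (le_of_mul_le_mul_left ?_ hlam0)
      have : lam * (1 / lam * c u + ∑ v, o u v * c v) = c u + lam * ∑ v, o u v * c v := by
        field_simp
      rw [this]
      linarith
    · have h3 : s u = deg E u / c u := by simp only [hs]; rw [if_neg h1, if_neg h2]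
      have h4 := (hhigh u h1 h2).2
      rw [h3, div_mul_cancel₀ _ h4.ne']
      have : 0 ≤ ∑ v, o u v * c v := sum_nonneg fun v _ => mul_nonneg (ho0 u v) (hc0 v)
      linarith

/-- If `8β + λ ≤ 3/8`, the pre-clustering `F` (connected components
of `G̃`) satisfies, for every `k ∈ [n]` and every clustering `D`:
`cost^k_F ≤ (3/β + 1/λ + 1/(βλ) + 8)·cost^k_D`; in particular with `D` an optimum
clustering, `cost^k_F ≤ (3/β + 1/λ + 1/(βλ) + 8)·opt^k`. -/
theorem preCluster_topK_approx [Fintype V] (E : V → V → Prop)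
    (hsymm : ∀ u v, E u v → E v u) (hrefl : ∀ u, E u u)
    (β lam : ℝ) (hβ0 : 0 < β) (hβ1 : β < 1) (hlam0 : 0 < lam) (hlam1 : lam < 1)
    (hβlam : 8 * β + lam ≤ 3 / 8)
    (k : ℕ) (hk1 : 1 ≤ k) (hk2 : k ≤ Fintype.card V) :
    ∀ D : V → ℕ,
      (costTopK E (preCluster β lam E) k : ℝ)
        ≤ (3 / β + 1 / lam + 1 / (β * lam) + 8) * (costTopK E D k : ℝ) := by
  intro D
  obtain ⟨g, hg0, hgr, hgc, hg⟩ := exists_charging_cut hsymm hrefl hβ0 hlam0 hlam1 D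
  obtain ⟨g', hg0', hgr', hgc', hg'⟩ :=
    exists_charging_inner hsymm hrefl hβ0 hlam0 hβlam D
  refine costTopK_le_of_charging E _ D (fun u v => g u v + g' u v) _ k hk1 hk2
    (fun u v => add_nonneg (hg0 u v) (hg0' u v)) ?_ ?_ ?_
  · intro u
    rw [sum_add_distrib]
    linarith [hgr u, hgr' u]
  · intro v
    rw [sum_add_distrib]
    linarith [hgc v, hgc' v]
  · intro u
    simp only [add_mul, sum_add_distrib]
    refine le_trans ?_ (add_le_add (hg u) (hg' u))
    rw [costC, filter_or]
    exact_mod_cast card_union_le _ _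

end
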